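/- For every nondeterministic Büchi automaton A over the alphabet V → Bool and all sets X, Y ⊆ V: if X is automata-dependent on Y in A, then X is dependent on Y in the language L(A). -/

import Mathlib

/-- A nondeterministic Büchi automaton over alphabet `Sig` with states `Q`. -/
structure NBA (Sig : Type*) (Q : Type*) where
  δ : Q → Sig → Set Q
  q0 : Q
  F : Set Q

/-- `ρ` is a run of `A` on the ω-word `w`. -/
def NBA.IsRun {Sig Q : Type*} (A : NBA Sig Q) (w : ℕ → Sig) (ρ : ℕ → Q) : Prop :=
  ρ 0 = A.q0 ∧ ∀ i, ρ (i + 1) ∈ A.δ (ρ i) (w i)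

/-- `ρ` is an accepting run of `A` on `w`: it visits `A.F` infinitely often. -/
def NBA.IsAcceptingRun {Sig Q : Type*} (A : NBA Sig Q) (w : ℕ → Sig) (ρ : ℕ → Q) : Prop :=
  A.IsRun w ρ ∧ ∀ n, ∃ i ≥ n, ρ i ∈ A.F

/-- The language of an NBA: all ω-words admitting an accepting run. -/
def NBA.Language {Sig Q : Type*} (A : NBA Sig Q) : Set (ℕ → Sig) :=
  { w | ∃ ρ, A.IsAcceptingRun w ρ }

/-- `r` is a finite run of `A` from `A.q0` to `s` labeled by the finite word `u`. -/
def NBA.IsFinRun {Sig Q : Type*} (A : NBA Sig Q) (u : List Sig) (r : ℕ → Q) (s : Q) : Prop :=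
  r 0 = A.q0 ∧ r u.length = s ∧
    ∀ j (h : j < u.length), r (j + 1) ∈ A.δ (r j) (u.get ⟨j, h⟩)

/-- The pair `(s, s')` is compatible in `A`: some finite word labels both
a finite run from `A.q0` to `s` and a finite run from `A.q0` to `s'`. -/
def NBA.Compatible {Sig Q : Type*} (A : NBA Sig Q) (s s' : Q) : Prop :=
  ∃ u : List Sig, (∃ r, A.IsFinRun u r s) ∧ (∃ r', A.IsFinRun u r' s')

/-- `A` is trim: every state and every transition lies on some accepting run. -/
def NBA.Trim {Sig Q : Type*} (A : NBA Sig Q) : Prop :=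
  (∀ q : Q, ∃ w ρ, A.IsAcceptingRun w ρ ∧ ∃ i, ρ i = q) ∧
  (∀ q σ q', q' ∈ A.δ q σ →
    ∃ w ρ, A.IsAcceptingRun w ρ ∧ ∃ i, ρ i = q ∧ w i = σ ∧ ρ (i + 1) = q')

/-- `X` is dependent on `Y` in the language `L`. -/
def DependentOn {V : Type*} (L : Set (ℕ → V → Bool)) (X Y : Set V) : Prop :=
  ∀ w ∈ L, ∀ w' ∈ L, ∀ i : ℕ,
    (∀ j < i, w j = w' j) → Set.EqOn (w i) (w' i) Y → Set.EqOn (w i) (w' i) X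

/-- `X` is dependent in `L`, i.e. dependent on `V \ X` in `L`. -/
def DependentIn {V : Type*} (L : Set (ℕ → V → Bool)) (X : Set V) : Prop :=
  DependentOn L X Xᶜ

/-- `X` is automata-dependent on `Y` in `A`. -/
def NBA.AutDepOn {V Q : Type*} (A : NBA (V → Bool) Q) (X Y : Set V) : Prop :=
  ∀ s s', A.Compatible s s' → ∀ σ σ' : V → Bool,
    Set.EqOn σ σ' Y → ¬ Set.EqOn σ σ' X →
    ¬ (A.δ s σ ≠ ∅ ∧ A.δ s' σ' ≠ ∅)

/-- The prefix of length `i` of a run is a finite run on any word that agrees with `w` before `i`. -/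
theorem NBA.IsRun.isFinRun_ofFn {Sig Q : Type*} {A : NBA Sig Q} {w u : ℕ → Sig} {ρ : ℕ → Q}
    (h : A.IsRun w ρ) {i : ℕ} (hu : ∀ j < i, u j = w j) :
    A.IsFinRun (List.ofFn fun j : Fin i => u j) ρ (ρ i) := by
  refine ⟨h.1, by rw [List.length_ofFn], fun j hj => ?_⟩
  have hji : j < i := by simpa using hj
  simpa [hu j hji] using h.2 j

/-- If `X` is automata-dependent on `Y` in `A`, then `X` is
dependent on `Y` in the language of `A`. -/
theorem automataDependent_imp_dependent {V Q : Type*} [Fintype V]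
    (A : NBA (V → Bool) Q) (X Y : Set V) (h : A.AutDepOn X Y) :
    DependentOn A.Language X Y := by
  rintro w ⟨ρ, hρ, -⟩ w' ⟨ρ', hρ', -⟩ i hpre hY
  by_contra hX
  exact h (ρ i) (ρ' i)
    ⟨_, ⟨ρ, hρ.isFinRun_ofFn fun _ _ => rfl⟩, ⟨ρ', hρ'.isFinRun_ofFn hpre⟩⟩
    (w i) (w' i) hY hX
    ⟨Set.Nonempty.ne_empty ⟨_, hρ.2 i⟩, Set.Nonempty.ne_empty ⟨_, hρ'.2 i⟩⟩
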